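/- Define g_{R,l}(ω) = ∫ e^{iR⟨ω,γ(s)⟩} χ(s) η_l(⟨ω, γ'(s)⟩) ds for a C² arclength-parametrized curve γ with nonvanishing curvature and χ smooth with small support, where η_l localizes ⟨ω,γ'(s)⟩ to |⟨ω,γ'(s)⟩| ≈ 2^{-l}. Then for 2^l ≥ R^{1/2} and 2^l ≤ R, (∫_{S^{d-1}} |g_{R,l}(ω)|² dω)^{1/2} ≤ C 2^{-l}(1 + log(2^{2l} R^{-1}))^{1/2}. -/

import Mathlib

open Real MeasureTheory
open scoped RealInnerProductSpace

section Sphere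

variable {E : Type*} [NormedAddCommGroup E] [InnerProductSpace ℝ E] {ι : Type*} [Fintype ι]

theorem norm_sub_le_sum_abs_inner (b : OrthonormalBasis ι ℝ E) (x y : E) :
    ‖x - y‖ ≤ ∑ i, |⟪b i, x⟫ - ⟪b i, y⟫| := by
  conv_lhs => rw [← b.sum_repr' (x - y)]
  refine (norm_sum_le _ _).trans (Finset.sum_le_sum fun i _ => ?_)
  rw [norm_smul, b.norm_eq_one, mul_one, inner_sub_right, Real.norm_eq_abs]

theorem sum_sq_inner_eq_one (b : OrthonormalBasis ι ℝ E) {x : E} (hx : ‖x‖ = 1) :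
    ∑ i, ⟪b i, x⟫ ^ 2 = 1 := by
  have := b.sum_sq_norm_inner_right x
  simpa [hx] using this

theorem norm_sub_le_of_cap [DecidableEq ι] (b : OrthonormalBasis ι ℝ E) (j : ι) {x y : E} {ε : ℝ}
    (hε : ε = 1 ∨ ε = -1) (hx : ‖x‖ = 1) (hy : ‖y‖ = 1)
    (hxj : 1 / (Fintype.card ι : ℝ) ≤ ε * ⟪b j, x⟫)
    (hyj : 1 / (Fintype.card ι : ℝ) ≤ ε * ⟪b j, y⟫) {r : ℝ}
    (hr0 : 0 ≤ r) (hr : ∀ i, i ≠ j → |⟪b i, x⟫ - ⟪b i, y⟫| ≤ r) :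
    ‖x - y‖ ≤ 2 * (Fintype.card ι : ℝ) ^ 2 * r := by
  set n : ℝ := (Fintype.card ι : ℝ) with hn
  have hn1 : 1 ≤ n := by
    have : 0 < Fintype.card ι := Fintype.card_pos_iff.mpr ⟨j⟩
    rw [hn]
    exact_mod_cast this
  have hS : ∑ i ∈ Finset.univ.erase j, |⟪b i, x⟫ - ⟪b i, y⟫| ≤ (n - 1) * r := by
    refine (Finset.sum_le_card_nsmul _ _ r fun i hi => hr i (Finset.ne_of_mem_erase hi)).trans ?_
    rw [Finset.card_erase_of_mem (Finset.mem_univ _), nsmul_eq_mul, Finset.card_univ,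
      Nat.cast_pred (Fintype.card_pos_iff.mpr ⟨j⟩)]
  have habs : ∀ z : E, ‖z‖ = 1 → ∀ i, |⟪b i, z⟫| ≤ 1 := fun z hz i => by
    simpa [hz] using abs_real_inner_le_norm (b i) z
  have hd : |⟪b j, x⟫ ^ 2 - ⟪b j, y⟫ ^ 2| ≤ 2 * ((n - 1) * r) := by
    have e1 := sum_sq_inner_eq_one b hx
    have e2 := sum_sq_inner_eq_one b hy
    rw [← Finset.add_sum_erase _ _ (Finset.mem_univ j)] at e1 e2
    have : ⟪b j, x⟫ ^ 2 - ⟪b j, y⟫ ^ 2 =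
        - ∑ i ∈ Finset.univ.erase j, (⟪b i, x⟫ ^ 2 - ⟪b i, y⟫ ^ 2) := by
      rw [Finset.sum_sub_distrib]; linarith
    rw [this, abs_neg]
    refine (Finset.abs_sum_le_sum_abs _ _).trans ?_
    refine le_trans ?_ (mul_le_mul_of_nonneg_left hS zero_le_two)
    rw [Finset.mul_sum]
    refine Finset.sum_le_sum fun i _ => ?_
    rw [sq_sub_sq, abs_mul]
    refine mul_le_mul_of_nonneg_right ?_ (abs_nonneg _)
    exact (abs_add_le _ _).trans (by linarith [habs x hx i, habs y hy i])
  have hj : |⟪b j, x⟫ - ⟪b j, y⟫| ≤ n * ((n - 1) * r) := by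
    have hsum : 2 / n ≤ |⟪b j, x⟫ + ⟪b j, y⟫| := by
      have : 2 / n = 1 / n + 1 / n := by ring
      rcases hε with rfl | rfl
      · exact le_trans (by linarith) (le_abs_self _)
      · exact le_trans (by linarith) (neg_le_abs _)
    rw [sq_sub_sq, abs_mul] at hd
    have h2 := (mul_le_mul_of_nonneg_right hsum (abs_nonneg (⟪b j, x⟫ - ⟪b j, y⟫))).trans hd
    rw [div_mul_eq_mul_div, div_le_iff₀ (by linarith)] at h2
    linarith
  refine (norm_sub_le_sum_abs_inner b x y).trans ?_
  rw [← Finset.add_sum_erase _ _ (Finset.mem_univ j)]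
  nlinarith [mul_nonneg (by linarith : 0 ≤ n) hr0]

theorem hausdorffMeasure_cap_le [MeasurableSpace E] [BorelSpace E]
    (b : OrthonormalBasis ι ℝ E) (j : ι) {ε : ℝ} (hε : ε = 1 ∨ ε = -1) {δ : ι → ℝ}
    (hδ : ∀ i, 0 ≤ δ i) :
    μH[(Fintype.card ι : ℝ) - 1] {x : E | ‖x‖ = 1 ∧ (∀ i, |⟪b i, x⟫| ≤ δ i) ∧
        1 / (Fintype.card ι : ℝ) ≤ ε * ⟪b j, x⟫} ≤
      ENNReal.ofReal ((2 * (Fintype.card ι : ℝ) ^ 2) ^ (Fintype.card ι - 1) *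
        (2 ^ (Fintype.card ι - 1) * (Fintype.card ι : ℝ)) * ∏ i, δ i) := by
  classical
  set T := {x : E | ‖x‖ = 1 ∧ (∀ i, |⟪b i, x⟫| ≤ δ i) ∧
        1 / (Fintype.card ι : ℝ) ≤ ε * ⟪b j, x⟫} with hT
  set n := Fintype.card ι with hn
  have hnpos : 0 < n := Fintype.card_pos_iff.mpr ⟨j⟩
  have hnR : (0 : ℝ) < n := by exact_mod_cast hnpos
  rcases T.eq_empty_or_nonempty with h0 | ⟨x₀, hx₀⟩
  · simp [h0]
  let pr : E → ({i // i ≠ j} → ℝ) := fun x i => ⟪b i, x⟫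
  let g := Function.invFunOn pr T
  have hg : ∀ y ∈ pr '' T, g y ∈ T ∧ pr (g y) = y := fun y hy =>
    ⟨Function.invFunOn_mem hy, Function.invFunOn_eq hy⟩
  have hlip : LipschitzOnWith (2 * (n : NNReal) ^ 2) g (pr '' T) := by
    refine LipschitzOnWith.of_dist_le_mul fun y hy z hz => ?_
    rw [dist_eq_norm]
    obtain ⟨hy1, hy2⟩ := hg y hy
    obtain ⟨hz1, hz2⟩ := hg z hz
    refine (norm_sub_le_of_cap b j hε hy1.1 hz1.1 hy1.2.2 hz1.2.2 (r := dist y z)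
      dist_nonneg fun i hi => ?_).trans (le_of_eq (by push_cast; rfl))
    have := dist_le_pi_dist (pr (g y)) (pr (g z)) ⟨i, hi⟩
    rwa [hy2, hz2, ← congrFun hy2, ← congrFun hz2, Real.dist_eq] at this
  have hsub : T ⊆ g '' (pr '' T) := by
    intro x hx
    refine ⟨pr x, ⟨x, hx, rfl⟩, ?_⟩
    obtain ⟨h1, h2⟩ := hg (pr x) ⟨x, hx, rfl⟩
    have := norm_sub_le_of_cap b j hε h1.1 hx.1 h1.2.2 hx.2.2 le_rfl (fun i hi => by
      have : ⟪b i, g (pr x)⟫ = ⟪b i, x⟫ := congrFun h2 ⟨i, hi⟩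
      rw [this, sub_self, abs_zero])
    rw [mul_zero] at this
    exact sub_eq_zero.mp (norm_le_zero_iff.mp this)
  have hcard : (n : ℝ) - 1 = (Fintype.card {i // i ≠ j} : ℝ) := by
    rw [Fintype.card_subtype_compl, Fintype.card_subtype_eq, Nat.cast_pred hnpos]
  have hcard' : Fintype.card {i // i ≠ j} = n - 1 := by
    rw [Fintype.card_subtype_compl, Fintype.card_subtype_eq]
  have hbox : pr '' T ⊆ Set.Icc (fun i => -δ i) (fun i => δ i) := by
    rintro _ ⟨x, hx, rfl⟩
    exact ⟨fun i => (abs_le.mp (hx.2.1 i)).1, fun i => (abs_le.mp (hx.2.1 i)).2⟩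
  have hvol : volume (pr '' T) ≤ ENNReal.ofReal (2 ^ (n - 1) * n * ∏ i, δ i) := by
    refine (measure_mono hbox).trans ?_
    rw [Real.volume_Icc_pi, ← ENNReal.ofReal_prod_of_nonneg (fun i _ => by linarith [hδ i])]
    refine ENNReal.ofReal_le_ofReal ?_
    have e1 : ∏ i : {i // i ≠ j}, (δ i - -δ i) = 2 ^ (n - 1) * ∏ i : {i // i ≠ j}, δ i := by
      rw [← hcard', ← Finset.card_univ, ← Finset.prod_const, ← Finset.prod_mul_distrib]
      exact Finset.prod_congr rfl fun i _ => by ring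
    have e2 : ∏ i, δ i = δ j * ∏ i : {i // i ≠ j}, δ i :=
      Fintype.prod_eq_mul_prod_subtype_ne δ j
    have hj : 1 ≤ n * δ j := by
      have h1 : 1 / (n : ℝ) ≤ δ j := by
        refine hx₀.2.2.trans ((le_abs_self _).trans ?_)
        rw [abs_mul]
        rcases hε with rfl | rfl <;> simpa using hx₀.2.1 j
      rwa [div_le_iff₀ hnR, mul_comm] at h1
    rw [e1, e2]
    have hP : 0 ≤ 2 ^ (n - 1) * ∏ i : {i // i ≠ j}, δ i :=
      mul_nonneg (by positivity) (Finset.prod_nonneg fun i _ => hδ i)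
    nlinarith
  calc μH[(n : ℝ) - 1] T ≤ μH[(n : ℝ) - 1] (g '' (pr '' T)) := measure_mono hsub
    _ ≤ ((2 * (n : NNReal) ^ 2 : NNReal) : ENNReal) ^ ((n : ℝ) - 1) * μH[(n : ℝ) - 1] (pr '' T) :=
      hlip.hausdorffMeasure_image_le (by rw [hcard]; positivity)
    _ ≤ ENNReal.ofReal ((2 * (n : ℝ) ^ 2) ^ (n - 1)) *
          ENNReal.ofReal (2 ^ (n - 1) * n * ∏ i, δ i) := by
      refine mul_le_mul' (le_of_eq ?_) ?_
      · rw [hcard, hcard', ENNReal.rpow_natCast, ENNReal.ofReal_pow (by positivity),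
          ← ENNReal.ofReal_coe_nnreal]
        push_cast
        rfl
      · rw [hcard, hausdorffMeasure_pi_real]
        exact hvol
    _ = _ := by
      rw [← ENNReal.ofReal_mul (by positivity)]
      congr 1
      ring

theorem exists_hausdorffMeasure_sphere_box_le [Nonempty ι] (E : Type*) [NormedAddCommGroup E]
    [InnerProductSpace ℝ E] [MeasurableSpace E] [BorelSpace E] :
    ∃ C : ℝ, 0 < C ∧ ∀ (b : OrthonormalBasis ι ℝ E) (δ : ι → ℝ), (∀ i, 0 ≤ δ i) →
      μH[(Fintype.card ι : ℝ) - 1] {x : E | ‖x‖ = 1 ∧ ∀ i, |⟪b i, x⟫| ≤ δ i} ≤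
        ENNReal.ofReal (C * ∏ i, δ i) := by
  classical
  set n := Fintype.card ι with hn
  have hnpos : 0 < n := Fintype.card_pos
  have hnR : (0 : ℝ) < n := by exact_mod_cast hnpos
  set K : ℝ := (2 * (n : ℝ) ^ 2) ^ (n - 1) * (2 ^ (n - 1) * (n : ℝ)) with hK
  have hKpos : 0 < K := by positivity
  refine ⟨n * (2 * K), by positivity, fun b δ hδ => ?_⟩
  have hP : 0 ≤ ∏ i, δ i := Finset.prod_nonneg fun i _ => hδ i
  let T : ι → ℝ → Set E := fun j ε => {x : E | ‖x‖ = 1 ∧ (∀ i, |⟪b i, x⟫| ≤ δ i) ∧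
        1 / (n : ℝ) ≤ ε * ⟪b j, x⟫}
  have hcover : {x : E | ‖x‖ = 1 ∧ ∀ i, |⟪b i, x⟫| ≤ δ i} ⊆ ⋃ j, (T j 1 ∪ T j (-1)) := by
    rintro x ⟨hx, hxδ⟩
    obtain ⟨j, hj⟩ : ∃ j, 1 / (n : ℝ) ≤ |⟪b j, x⟫| := by
      by_contra! h
      have h1 : ∀ i, ⟪b i, x⟫ ^ 2 < 1 / n := fun i => by
        have h2 : |⟪b i, x⟫| ≤ 1 := by simpa [hx] using abs_real_inner_le_norm (b i) x
        rw [← sq_abs]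
        nlinarith [h i, abs_nonneg ⟪b i, x⟫]
      have h3 := Finset.sum_lt_sum_of_nonempty (Finset.univ_nonempty (α := ι))
        (fun i _ => h1 i)
      rw [sum_sq_inner_eq_one b hx, Finset.sum_const, Finset.card_univ, nsmul_eq_mul,
        ← hn, mul_one_div_cancel hnR.ne'] at h3
      exact lt_irrefl _ h3
    refine Set.mem_iUnion.mpr ⟨j, ?_⟩
    rcases le_abs.mp hj with h | h
    · exact Or.inl ⟨hx, hxδ, by simpa using h⟩
    · exact Or.inr ⟨hx, hxδ, by simpa using h⟩
  refine (measure_mono hcover).trans ((measure_iUnion_le _).trans ?_)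
  rw [tsum_fintype]
  have hj : ∀ j, μH[(n : ℝ) - 1] (T j 1 ∪ T j (-1)) ≤ ENNReal.ofReal (2 * K * ∏ i, δ i) := by
    intro j
    refine (measure_union_le _ _).trans ((add_le_add
      (hausdorffMeasure_cap_le b j (Or.inl rfl) hδ)
      (hausdorffMeasure_cap_le b j (Or.inr rfl) hδ)).trans ?_)
    rw [← ENNReal.ofReal_add (by positivity) (by positivity)]
    exact ENNReal.ofReal_le_ofReal (le_of_eq (by rw [hK]; ring))
  refine (Finset.sum_le_card_nsmul _ _ _ fun j _ => hj j).trans (le_of_eq ?_)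
  rw [Finset.card_univ, nsmul_eq_mul, ← hn, ← ENNReal.ofReal_natCast,
    ← ENNReal.ofReal_mul (by positivity)]
  congr 1
  ring

end Sphere

section Divergence

variable {E : Type*} [NormedAddCommGroup E] [InnerProductSpace ℝ E] [FiniteDimensional ℝ E]
  [MeasurableSpace E] [BorelSpace E] {σ : Measure E} [IsFiniteMeasure σ]

theorem integrable_of_continuous_of_ae_norm_eq_one {F : Type*} [NormedAddCommGroup F]
    (h1 : ∀ᵐ ω ∂σ, ‖ω‖ = 1) {f : E → F} (hf : Continuous f) : Integrable f σ := by
  obtain ⟨C, hC⟩ := (isCompact_sphere (0 : E) 1).exists_bound_of_continuousOn hf.continuousOn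
  refine Integrable.of_bound hf.aestronglyMeasurable C ?_
  filter_upwards [h1] with ω hω
  exact hC ω (by simpa using hω)

/-- Rotation-invariant measures on the unit sphere do not see derivatives along rotations. -/
theorem integral_fderiv_skewAdjoint_eq_zero (h1 : ∀ᵐ ω ∂σ, ‖ω‖ = 1)
    (hσ : ∀ e : E ≃ₗᵢ[ℝ] E, MeasurePreserving e σ σ) {A : E →L[ℝ] E}
    (hA : A ∈ skewAdjoint (E →L[ℝ] E)) {G : E → ℂ} (hG : ContDiff ℝ 1 G) :
    ∫ ω, fderiv ℝ G ω (A ω) ∂σ = 0 := by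
  let _ : NormedAlgebra ℚ (E →L[ℝ] E) := NormedAlgebra.restrictScalars ℚ ℝ (E →L[ℝ] E)
  have hU : ∀ θ : ℝ, NormedSpace.exp (θ • A) ∈ unitary (E →L[ℝ] E) := fun θ =>
    NormedSpace.exp_mem_unitary_of_mem_skewAdjoint (skewAdjoint.smul_mem θ hA)
  let U : ℝ → E →L[ℝ] E := fun θ => NormedSpace.exp (θ • A)
  have hUn : ∀ θ ω, ‖U θ ω‖ = ‖ω‖ := fun θ ω =>
    ContinuousLinearMap.norm_map_of_mem_unitary (hU θ) ω
  have hUd : ∀ θ ω, HasDerivAt (fun θ => U θ ω) (U θ (A ω)) θ := fun θ ω =>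
    by simpa using (hasDerivAt_exp_smul_const A θ).clm_apply (hasDerivAt_const θ ω)
  have hinv : ∀ θ, ∫ ω, G (U θ ω) ∂σ = ∫ ω, G ω ∂σ := fun θ => by
    let e := Unitary.linearIsometryEquiv ⟨_, hU θ⟩
    exact (hσ e).integral_comp e.toHomeomorph.measurableEmbedding G
  have hcont : Continuous (fderiv ℝ G) := hG.continuous_fderiv one_ne_zero
  obtain ⟨C, hC⟩ := (isCompact_sphere (0 : E) 1).exists_bound_of_continuousOn hcont.continuousOn
  have key := hasDerivAt_integral_of_dominated_loc_of_deriv_le (μ := σ) (𝕜 := ℝ)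
    (F := fun θ ω => G (U θ ω)) (F' := fun θ ω => fderiv ℝ G (U θ ω) (U θ (A ω)))
    (x₀ := 0) (s := Set.univ) (bound := fun _ => C * ‖A‖) Filter.univ_mem
    (Filter.Eventually.of_forall fun θ =>
      (hG.continuous.comp (U θ).continuous).aestronglyMeasurable)
    (integrable_of_continuous_of_ae_norm_eq_one h1 (hG.continuous.comp (U 0).continuous))
    ((hcont.comp (U 0).continuous).clm_apply
      ((U 0).continuous.comp A.continuous)).aestronglyMeasurable
    (by
      filter_upwards [h1] with ω hω θ _
      refine ((fderiv ℝ G (U θ ω)).le_opNorm _).trans ?_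
      rw [hUn]
      have hCω := hC (U θ ω) (by simp [hUn, hω])
      refine mul_le_mul hCω ?_ (norm_nonneg _) ((norm_nonneg _).trans hCω)
      simpa [hω] using A.le_opNorm ω)
    (integrable_const _)
    (by
      filter_upwards with ω θ _
      exact ((hG.differentiable one_ne_zero _).hasFDerivAt.comp_hasDerivAt θ (hUd θ ω)))
  have h0 := key.2
  simp only [hinv] at h0
  have h := h0.unique (hasDerivAt_const _ _)
  simpa [U] using h

/-- The divergence theorem on the sphere for the tangential part of a constant field. -/
theorem integral_fderiv_tangential {ι : Type*} [Fintype ι] (b : OrthonormalBasis ι ℝ E)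
    (h1 : ∀ᵐ ω ∂σ, ‖ω‖ = 1)
    (hσ : ∀ e : E ≃ₗᵢ[ℝ] E, MeasurePreserving e σ σ) (u : E) {G : E → ℂ} (hG : ContDiff ℝ 1 G) :
    ∫ ω, fderiv ℝ G ω (u - ⟪u, ω⟫ • ω) ∂σ =
      ∫ ω, (((Fintype.card ι : ℝ) - 1) * ⟪u, ω⟫) • G ω ∂σ := by
  let A : ι → E →L[ℝ] E := fun j =>
    InnerProductSpace.rankOne ℝ u (b j) - InnerProductSpace.rankOne ℝ (b j) u
  have hAx : ∀ j ω, A j ω = ⟪b j, ω⟫ • u - ⟪u, ω⟫ • b j := fun j ω => by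
    simp [A, InnerProductSpace.rankOne_apply]
  have hA : ∀ j, A j ∈ skewAdjoint (E →L[ℝ] E) := fun j => by
    rw [skewAdjoint.mem_iff, ContinuousLinearMap.star_eq_adjoint]
    simp [A, InnerProductSpace.adjoint_rankOne]
  have hI : ∀ j, ContDiff ℝ 1 (fun ω : E => ⟪b j, ω⟫) := fun j => (innerSL ℝ (b j)).contDiff
  have hGj : ∀ j, ContDiff ℝ 1 (fun ω => ⟪b j, ω⟫ • G ω) := fun j => (hI j).smul hG
  have hz : ∀ j, ∫ ω, fderiv ℝ (fun ω => ⟪b j, ω⟫ • G ω) ω (A j ω) ∂σ = 0 := fun j =>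
    integral_fderiv_skewAdjoint_eq_zero h1 hσ (hA j) (hGj j)
  have h_int : ∀ j, Integrable
      (fun ω => fderiv ℝ (fun ω => ⟪b j, ω⟫ • G ω) ω (A j ω)) σ := fun j =>
    integrable_of_continuous_of_ae_norm_eq_one h1
      (((hGj j).continuous_fderiv one_ne_zero).clm_apply (A j).continuous)
  have hsum : ∫ ω, ∑ j, fderiv ℝ (fun ω => ⟪b j, ω⟫ • G ω) ω (A j ω) ∂σ = 0 := by
    rw [integral_finsetSum _ fun j _ => h_int j]
    exact Finset.sum_eq_zero fun j _ => hz j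
  have hpt : ∀ ω : E, ‖ω‖ = 1 → ∑ j, fderiv ℝ (fun ω => ⟪b j, ω⟫ • G ω) ω (A j ω) =
      fderiv ℝ G ω (u - ⟪u, ω⟫ • ω) - (((Fintype.card ι : ℝ) - 1) * ⟪u, ω⟫) • G ω := by
    intro ω hω
    have hd : ∀ j, fderiv ℝ (fun ω => ⟪b j, ω⟫ • G ω) ω (A j ω) =
        fderiv ℝ G ω (⟪b j, ω⟫ • A j ω) + ⟪b j, A j ω⟫ • G ω := fun j => by
      rw [fderiv_fun_smul ((hI j).differentiable one_ne_zero ω)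
        (hG.differentiable one_ne_zero ω)]
      have : fderiv ℝ (fun ω : E => ⟪b j, ω⟫) ω = innerSL ℝ (b j) :=
        (innerSL ℝ (b j)).fderiv
      simp [this]
    have e1 : ∑ j, ⟪b j, ω⟫ • A j ω = u - ⟪u, ω⟫ • ω := by
      have : ∀ j, ⟪b j, ω⟫ • A j ω = (⟪b j, ω⟫ ^ 2) • u - ⟪u, ω⟫ • (⟪b j, ω⟫ • b j) := fun j => by
        rw [hAx, smul_sub, smul_smul, smul_smul, smul_smul, sq, mul_comm ⟪u, ω⟫]
      rw [Finset.sum_congr rfl fun j _ => this j, Finset.sum_sub_distrib, ← Finset.sum_smul,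
        ← Finset.smul_sum, b.sum_repr', sum_sq_inner_eq_one b hω, one_smul]
    have e2 : ∑ j, ⟪b j, A j ω⟫ = -(((Fintype.card ι : ℝ) - 1) * ⟪u, ω⟫) := by
      have : ∀ j, ⟪b j, A j ω⟫ = ⟪u, b j⟫ * ⟪b j, ω⟫ - ⟪u, ω⟫ := fun j => by
        rw [hAx, inner_sub_right, inner_smul_right, inner_smul_right,
          real_inner_self_eq_norm_sq, b.norm_eq_one, real_inner_comm u (b j)]
        ring
      rw [Finset.sum_congr rfl fun j _ => this j, Finset.sum_sub_distrib,
        b.sum_inner_mul_inner, Finset.sum_const, Finset.card_univ, nsmul_eq_mul]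
      ring
    rw [Finset.sum_congr rfl fun j _ => hd j, Finset.sum_add_distrib, ← map_sum, e1,
      ← Finset.sum_smul, e2, neg_smul]
    exact (sub_eq_add_neg _ _).symm
  rw [integral_congr_ae (g := fun ω => fderiv ℝ G ω (u - ⟪u, ω⟫ • ω) -
    (((Fintype.card ι : ℝ) - 1) * ⟪u, ω⟫) • G ω)
    (h1.mono fun ω hω => hpt ω hω), integral_sub, sub_eq_zero] at hsum
  · exact hsum
  · refine integrable_of_continuous_of_ae_norm_eq_one h1
      ((hG.continuous_fderiv one_ne_zero).clm_apply ?_)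
    fun_prop
  · refine integrable_of_continuous_of_ae_norm_eq_one h1 ?_
    have := hG.continuous
    fun_prop

end Divergence

section Oscillatory

theorem exists_contDiff_mul_one_sub_sq_eq_one :
    ∃ h : ℝ → ℝ, ContDiff ℝ 1 h ∧ (∀ x, |x| ≤ 1 / 2 → h x * (1 - x ^ 2) = 1) ∧
      ∃ C, 0 < C ∧ ∀ x, |x| ≤ 1 → |h x| ≤ C ∧ |deriv h x| ≤ C := by
  let f : ContDiffBump (0 : ℝ) := ⟨1 / 2, 3 / 4, by norm_num, by norm_num⟩
  have hpos : ∀ x : ℝ, 0 < 1 - f x * x ^ 2 := fun x => by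
    by_cases hx : 3 / 4 ≤ |x|
    · rw [f.zero_of_le_dist (by simpa [Real.dist_eq] using hx)]
      norm_num
    · push Not at hx
      have : x ^ 2 < (3 / 4) ^ 2 := by
        rw [← sq_abs]
        exact pow_lt_pow_left₀ hx (abs_nonneg x) two_ne_zero
      nlinarith [f.le_one (x := x), f.nonneg (x := x), sq_nonneg x]
  have hC1 : ContDiff ℝ 1 (fun x => (1 - f x * x ^ 2)⁻¹) :=
    (contDiff_const.sub (f.contDiff.mul (contDiff_id.pow 2))).inv fun x => (hpos x).ne'
  refine ⟨fun x => (1 - f x * x ^ 2)⁻¹, hC1, fun x hx => ?_, ?_⟩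
  · have h1 : f x = 1 := f.one_of_mem_closedBall (by
      change dist x 0 ≤ 1 / 2
      rwa [Real.dist_eq, sub_zero])
    have := (hpos x).ne'
    rw [h1, one_mul] at this
    simp only [h1, one_mul]
    exact inv_mul_cancel₀ this
  · obtain ⟨C₁, hC₁⟩ := (isCompact_Icc (a := (-1 : ℝ)) (b := 1)).exists_bound_of_continuousOn
      hC1.continuous.continuousOn
    obtain ⟨C₂, hC₂⟩ := (isCompact_Icc (a := (-1 : ℝ)) (b := 1)).exists_bound_of_continuousOn
      (hC1.continuous_deriv le_rfl).continuousOn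
    refine ⟨max (max C₁ C₂) 1, by positivity, fun x hx => ⟨?_, ?_⟩⟩
    · exact (hC₁ x (abs_le.mp hx)).trans (le_max_of_le_left (le_max_left _ _))
    · exact (hC₂ x (abs_le.mp hx)).trans (le_max_of_le_left (le_max_right _ _))

/-- A single integration by parts on the sphere. -/
theorem exists_norm_integral_exp_mul_le (n : ℕ) :
    ∃ C : ℝ, 0 < C ∧ ∀ {E : Type} [NormedAddCommGroup E] [InnerProductSpace ℝ E]
      [FiniteDimensional ℝ E] [MeasurableSpace E] [BorelSpace E] {σ : Measure E}
      [IsFiniteMeasure σ] (_ : OrthonormalBasis (Fin n) ℝ E) (_ : ∀ᵐ ω ∂σ, ‖ω‖ = 1)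
      (_ : ∀ e : E ≃ₗᵢ[ℝ] E, MeasurePreserving e σ σ) {u : E} (_ : ‖u‖ = 1)
      {a : E → ℝ} (_ : ContDiff ℝ 1 a) {W : Set E} (_ : MeasurableSet W) {M₀ M₁ lam : ℝ}
      (_ : 0 ≤ M₀) (_ : 0 ≤ M₁) (_ : 0 < lam)
      (_ : ∀ ω ∉ W, a ω = 0 ∧ fderiv ℝ a ω = 0)
      (_ : ∀ ω ∈ W, ‖ω‖ = 1 → |⟪u, ω⟫| ≤ 1 / 2 ∧ |a ω| ≤ M₀ ∧ ‖fderiv ℝ a ω‖ ≤ M₁),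
      ‖∫ ω, Complex.exp (Complex.I * ((lam * ⟪u, ω⟫ : ℝ) : ℂ)) * (a ω : ℂ) ∂σ‖ ≤
        C / lam * (M₀ + M₁) * σ.real W := by
  obtain ⟨h, hh, hh1, K, hK, hhK⟩ := exists_contDiff_mul_one_sub_sq_eq_one
  refine ⟨K * (n + 3), by positivity, ?_⟩
  intro E _ _ _ _ _ σ _ b h1 hσ u hu a ha W hW M₀ M₁ lam hM₀ hM₁ hlam hout hin
  set e : E → ℂ := fun ω => Complex.exp (Complex.I * ((lam * ⟪u, ω⟫ : ℝ) : ℂ)) with he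
  have hI : ContDiff ℝ 1 (fun ω : E => ⟪u, ω⟫) := (innerSL ℝ u).contDiff
  have hId : ∀ ω, HasFDerivAt (fun ω : E => ⟪u, ω⟫) (innerSL ℝ u) ω := fun ω =>
    (innerSL ℝ u).hasFDerivAt
  have hec : ContDiff ℝ 1 e :=
    (contDiff_const.mul (Complex.ofRealCLM.contDiff.comp (contDiff_const.mul hI))).cexp
  have hen : ∀ ω, ‖e ω‖ = 1 := fun ω => by
    rw [he]
    simp only
    rw [mul_comm]
    exact Complex.norm_exp_ofReal_mul_I _
  let p : E → ℝ := fun ω => h ⟪u, ω⟫ * a ω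
  have hp : ContDiff ℝ 1 p := (hh.comp hI).mul ha
  let G : E → ℂ := fun ω => e ω * (p ω : ℂ)
  have hG : ContDiff ℝ 1 G := hec.mul (Complex.ofRealCLM.contDiff.comp hp)
  have hed : ∀ ω v, fderiv ℝ e ω v = Complex.I * ((lam * ⟪u, v⟫ : ℝ) : ℂ) * e ω := fun ω v => by
    have := ((Complex.ofRealCLM.hasFDerivAt.comp ω ((hId ω).const_mul lam)).const_mul
      Complex.I).cexp
    have h2 : HasFDerivAt e _ ω := this
    rw [h2.fderiv]
    simp [he]
    ring
  have hpd : ∀ ω v, fderiv ℝ p ω v =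
      h ⟪u, ω⟫ * fderiv ℝ a ω v + a ω * (deriv h ⟪u, ω⟫ * ⟪u, v⟫) := fun ω v => by
    have h3 : HasFDerivAt (fun ω => h ⟪u, ω⟫) _ ω :=
      ((hh.differentiable one_ne_zero _).hasDerivAt.comp_hasFDerivAt ω (hId ω))
    have h2 : HasFDerivAt p _ ω := h3.mul (ha.differentiable one_ne_zero ω).hasFDerivAt
    rw [h2.fderiv]
    simp
  have hGd : ∀ ω v, fderiv ℝ G ω v = e ω * (fderiv ℝ p ω v : ℂ) +
      p ω * (Complex.I * ((lam * ⟪u, v⟫ : ℝ) : ℂ) * e ω) := fun ω v => by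
    have h3 : HasFDerivAt (fun ω => (p ω : ℂ)) _ ω :=
      (Complex.ofRealCLM.hasFDerivAt.comp ω (hp.differentiable one_ne_zero ω).hasFDerivAt)
    have h2 : HasFDerivAt G _ ω :=
      (hec.differentiable one_ne_zero ω).hasFDerivAt.mul h3
    rw [h2.fderiv]
    simp [hed]
  let V : E → E := fun ω => u - ⟪u, ω⟫ • ω
  have hVc : Continuous V := by fun_prop
  let q : E → ℝ := fun ω => fderiv ℝ p ω (V ω) - ((n : ℝ) - 1) * ⟪u, ω⟫ * p ω
  have hea : Integrable (fun ω => e ω * (a ω : ℂ)) σ :=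
    integrable_of_continuous_of_ae_norm_eq_one h1
      (hec.continuous.mul (Complex.continuous_ofReal.comp ha.continuous))
  have hdiv := integral_fderiv_tangential b h1 hσ u hG
  have hi1 : Integrable (fun ω => fderiv ℝ G ω (V ω)) σ :=
    integrable_of_continuous_of_ae_norm_eq_one h1
      ((hG.continuous_fderiv one_ne_zero).clm_apply hVc)
  have hi2 : Integrable (fun ω => (((Fintype.card (Fin n) : ℝ) - 1) * ⟪u, ω⟫) • G ω) σ := by
    refine integrable_of_continuous_of_ae_norm_eq_one h1 ?_
    have := hG.continuous
    fun_prop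
  have hi12 : Integrable (fun ω => fderiv ℝ G ω (V ω) -
      (((Fintype.card (Fin n) : ℝ) - 1) * ⟪u, ω⟫) • G ω) σ := hi1.sub hi2
  have hpt : ∀ ω, ‖ω‖ = 1 → fderiv ℝ G ω (V ω) - (((Fintype.card (Fin n) : ℝ) - 1) * ⟪u, ω⟫) • G ω
      - Complex.I * lam * (e ω * (a ω : ℂ)) = e ω * (q ω : ℂ) := by
    intro ω hω
    have hV : ⟪u, V ω⟫ = 1 - ⟪u, ω⟫ ^ 2 := by
      simp only [V]
      rw [inner_sub_right, inner_smul_right, real_inner_self_eq_norm_sq, hu]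
      ring
    have hpa : p ω * (1 - ⟪u, ω⟫ ^ 2) = a ω := by
      by_cases hωW : ω ∈ W
      · have := hh1 _ (hin ω hωW hω).1
        simp only [p]
        linear_combination a ω * this
      · simp [p, (hout ω hωW).1]
    rw [hGd, hV, ← hpa]
    simp only [q, G, Fintype.card_fin, Complex.real_smul]
    push_cast
    ring
  have hqb : ∀ ω, ‖ω‖ = 1 → ‖e ω * (q ω : ℂ)‖ ≤
      W.indicator (fun _ => K * (n + 3) * (M₀ + M₁)) ω := by
    intro ω hω
    rw [norm_mul, hen, one_mul, Complex.norm_real, Real.norm_eq_abs]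
    by_cases hωW : ω ∈ W
    · rw [Set.indicator_of_mem hωW]
      obtain ⟨hx, h0, hd⟩ := hin ω hωW hω
      obtain ⟨k1, k2⟩ := hhK ⟪u, ω⟫ (hx.trans (by norm_num))
      have hVn : ‖V ω‖ ≤ 2 := by
        refine (norm_sub_le _ _).trans ?_
        rw [norm_smul, hu, hω, Real.norm_eq_abs]
        linarith
      have huV : |⟪u, V ω⟫| ≤ 2 := by
        refine (abs_real_inner_le_norm _ _).trans ?_
        rw [hu, one_mul]
        exact hVn
      have hda : |fderiv ℝ a ω (V ω)| ≤ M₁ * 2 :=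
        ((fderiv ℝ a ω).le_opNorm _).trans (mul_le_mul hd hVn (norm_nonneg _) hM₁)
      have t1 : |h ⟪u, ω⟫ * fderiv ℝ a ω (V ω)| ≤ K * (M₁ * 2) := by
        rw [abs_mul]
        exact mul_le_mul k1 hda (abs_nonneg _) hK.le
      have t2 : |a ω * (deriv h ⟪u, ω⟫ * ⟪u, V ω⟫)| ≤ M₀ * (K * 2) := by
        rw [abs_mul, abs_mul]
        exact mul_le_mul h0 (mul_le_mul k2 huV (abs_nonneg _) hK.le) (by positivity) hM₀
      have hn1 : |(n : ℝ) - 1| ≤ n + 1 := by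
        rw [abs_le]
        constructor <;> linarith [(Nat.cast_nonneg n : (0 : ℝ) ≤ n)]
      have t3 : |((n : ℝ) - 1) * ⟪u, ω⟫ * p ω| ≤ (n + 1) * 1 * (K * M₀) := by
        simp only [p]
        rw [abs_mul, abs_mul, abs_mul]
        refine mul_le_mul (mul_le_mul hn1 (hx.trans (by norm_num)) (abs_nonneg _) (by positivity))
          (mul_le_mul k1 h0 (abs_nonneg _) hK.le) (by positivity) (by positivity)
      have : |q ω| ≤ K * (M₁ * 2) + M₀ * (K * 2) + (n + 1) * 1 * (K * M₀) := by
        simp only [q]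
        rw [hpd]
        refine (abs_sub _ _).trans (add_le_add ((abs_add_le _ _).trans (add_le_add t1 t2)) t3)
      refine this.trans ?_
      nlinarith [mul_nonneg (mul_nonneg hK.le hM₁) (Nat.cast_nonneg n : (0 : ℝ) ≤ n),
        mul_nonneg hK.le hM₁]
    · rw [Set.indicator_of_notMem hωW]
      obtain ⟨h0, hd⟩ := hout ω hωW
      simp [q, hpd, h0, hd, p]
  have h_int : Complex.I * lam * ∫ ω, e ω * (a ω : ℂ) ∂σ = -∫ ω, e ω * (q ω : ℂ) ∂σ := by
    rw [← integral_congr_ae (h1.mono fun ω hω => hpt ω hω),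
      integral_sub hi12 (hea.const_mul _), integral_sub hi1 hi2, hdiv, sub_self,
      zero_sub, neg_neg, integral_const_mul]
  have hfin : lam * ‖∫ ω, e ω * (a ω : ℂ) ∂σ‖ ≤ K * (n + 3) * (M₀ + M₁) * σ.real W := by
    have : lam * ‖∫ ω, e ω * (a ω : ℂ) ∂σ‖ = ‖∫ ω, e ω * (q ω : ℂ) ∂σ‖ := by
      rw [← norm_neg (∫ ω, e ω * (q ω : ℂ) ∂σ), ← h_int, norm_mul, norm_mul, Complex.norm_I,
        Complex.norm_real, Real.norm_of_nonneg hlam.le, one_mul]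
    rw [this]
    refine (norm_integral_le_of_norm_le ((integrable_const _).indicator hW)
      (h1.mono fun ω hω => hqb ω hω)).trans (le_of_eq ?_)
    rw [integral_indicator hW, setIntegral_const, smul_eq_mul, mul_comm]
  rw [div_mul_eq_mul_div, div_mul_eq_mul_div, le_div_iff₀ hlam, mul_comm]
  exact hfin

end Oscillatory

section HausdorffSphere

/-- The surface measure of the unit sphere in `ℝᵈ`. -/
noncomputable abbrev sphereMeasure (d : ℕ) : Measure (EuclideanSpace ℝ (Fin d)) :=
  μH[(d : ℝ) - 1].restrict (Metric.sphere 0 1)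

variable {d : ℕ}

theorem ae_norm_eq_one_sphereMeasure : ∀ᵐ ω ∂(sphereMeasure d), ‖ω‖ = 1 := by
  filter_upwards [ae_restrict_mem (Metric.isClosed_sphere.measurableSet)] with ω hω
  simpa using hω

theorem measurePreserving_sphereMeasure
    (e : EuclideanSpace ℝ (Fin d) ≃ₗᵢ[ℝ] EuclideanSpace ℝ (Fin d)) :
    MeasurePreserving e (sphereMeasure d) (sphereMeasure d) := by
  have h := (e.toIsometryEquiv.measurePreserving_hausdorffMeasure
    ((d : ℝ) - 1)).restrict_preimage (s := Metric.sphere 0 1) Metric.isClosed_sphere.measurableSet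
  have hs : e.toIsometryEquiv ⁻¹' Metric.sphere 0 1 = Metric.sphere 0 1 := by
    ext ω
    simp
  rw [hs] at h
  exact h

theorem exists_sphereMeasure_box_le (hd : 0 < d) :
    ∃ C : ℝ, 0 < C ∧ ∀ (b : OrthonormalBasis (Fin d) ℝ (EuclideanSpace ℝ (Fin d)))
      (δ : Fin d → ℝ), (∀ i, 0 ≤ δ i) →
      sphereMeasure d {x | ∀ i, |⟪b i, x⟫| ≤ δ i} ≤ ENNReal.ofReal (C * ∏ i, δ i) := by
  have : Nonempty (Fin d) := ⟨⟨0, hd⟩⟩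
  obtain ⟨C, hC, h⟩ := exists_hausdorffMeasure_sphere_box_le (ι := Fin d)
    (EuclideanSpace ℝ (Fin d))
  refine ⟨C, hC, fun b δ hδ => ?_⟩
  rw [sphereMeasure, Measure.restrict_apply' Metric.isClosed_sphere.measurableSet]
  refine le_trans (le_of_eq ?_) (h b δ hδ)
  rw [Fintype.card_fin]
  congr 1
  ext x
  simp [and_comm]

theorem isFiniteMeasure_sphereMeasure (hd : 0 < d) : IsFiniteMeasure (sphereMeasure d) := by
  obtain ⟨C, -, h⟩ := exists_sphereMeasure_box_le hd
  refine ⟨?_⟩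
  have hb := h (EuclideanSpace.basisFun (Fin d) ℝ) (fun _ => 1) fun _ => zero_le_one
  refine ((measure_mono_ae ?_).trans hb).trans_lt ENNReal.ofReal_lt_top
  filter_upwards [ae_norm_eq_one_sphereMeasure (d := d)] with x hx _ i
  simpa only [OrthonormalBasis.norm_eq_one, hx, one_mul] using
    abs_real_inner_le_norm (EuclideanSpace.basisFun (Fin d) ℝ i) x

theorem exists_sphereMeasure_slab_le (hd : 2 ≤ d) :
    ∃ C : ℝ, 0 < C ∧ ∀ p q : EuclideanSpace ℝ (Fin d), ‖p‖ = 1 → ‖q‖ = 1 → 0 ≤ ⟪p, q⟫ →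
      ∀ δ : ℝ, 0 ≤ δ →
        (sphereMeasure d).real {x | |⟪p, x⟫| ≤ δ ∧ |⟪q, x⟫| ≤ δ} ≤ C * δ ∧
        (p ≠ q → (sphereMeasure d).real {x | |⟪p, x⟫| ≤ δ ∧ |⟪q, x⟫| ≤ δ} ≤
          C * δ ^ 2 / ‖p - q‖) := by
  obtain ⟨C, hC, h⟩ := exists_sphereMeasure_box_le (d := d) (by omega)
  let i₀ : Fin d := ⟨0, by omega⟩
  let i₁ : Fin d := ⟨1, by omega⟩
  have h01 : i₀ ≠ i₁ := by simp [i₀, i₁]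
  have hmono : ∀ {S T : Set (EuclideanSpace ℝ (Fin d))} {r : ℝ}, 0 ≤ r →
      (∀ x, ‖x‖ = 1 → x ∈ S → x ∈ T) → sphereMeasure d T ≤ ENNReal.ofReal r →
      (sphereMeasure d).real S ≤ r := fun {S T r} hr hST hT => by
    refine ENNReal.toReal_le_of_le_ofReal hr ((measure_mono_ae ?_).trans hT)
    filter_upwards [ae_norm_eq_one_sphereMeasure (d := d)] with x hx hxS
    exact hST x hx hxS
  have hcard : Module.finrank ℝ (EuclideanSpace ℝ (Fin d)) = Fintype.card (Fin d) := by simp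
  refine ⟨4 * C, by positivity, fun p q hp hq hpq δ hδ => ⟨?_, fun hne => ?_⟩⟩
  · obtain ⟨b, hb⟩ := Orthonormal.exists_orthonormalBasis_extension_of_card_eq (𝕜 := ℝ) hcard
      (v := fun _ => p) (s := {i₀}) (by
        constructor
        · intro i
          simpa using hp
        · intro i j hij
          exact absurd (Subsingleton.elim i j) hij)
    have hb0 : b i₀ = p := hb i₀ rfl
    refine (hmono (r := C * δ) (by positivity) ?_ ((h b (fun i => if i = i₀ then δ else 1)
      fun i => by split_ifs <;> linarith).trans (le_of_eq ?_))).trans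
        (by nlinarith [mul_nonneg hC.le hδ])
    · intro x hx hxS i
      split_ifs with hi
      · rw [hi, hb0]
        exact hxS.1
      · simpa [hx] using abs_real_inner_le_norm (b i) x
    · rw [Finset.prod_ite_eq' Finset.univ i₀ (fun _ => δ)]
      simp
  · set w := q - ⟪p, q⟫ • p with hw
    have hpw : ⟪p, w⟫ = 0 := by
      rw [hw, inner_sub_right, inner_smul_right, real_inner_self_eq_norm_sq, hp]
      ring
    have hwn : ‖p - q‖ ^ 2 ≤ 2 * ‖w‖ ^ 2 := by
      have e1 : ‖w‖ ^ 2 = 1 - ⟪p, q⟫ ^ 2 := by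
        rw [hw, norm_sub_sq_real, norm_smul, inner_smul_right, real_inner_comm, hp, hq,
          Real.norm_eq_abs, mul_one, sq_abs]
        ring
      have e2 : ‖p - q‖ ^ 2 = 2 - 2 * ⟪p, q⟫ := by
        rw [norm_sub_sq_real, hp, hq]
        ring
      have e3 : ⟪p, q⟫ ≤ 1 := by simpa [hp, hq] using real_inner_le_norm p q
      rw [e1, e2]
      nlinarith
    have hpqn : 0 < ‖p - q‖ := norm_pos_iff.mpr (sub_ne_zero.mpr hne)
    have hw0 : 0 < ‖w‖ := by
      by_contra! h0
      have : ‖w‖ = 0 := le_antisymm h0 (norm_nonneg _)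
      rw [this] at hwn
      nlinarith
    have hwn' : ‖p - q‖ ≤ 2 * ‖w‖ := by
      refine abs_le_of_sq_le_sq' ?_ (by positivity) |>.2
      nlinarith [sq_nonneg ‖w‖]
    obtain ⟨b, hb⟩ := Orthonormal.exists_orthonormalBasis_extension_of_card_eq (𝕜 := ℝ) hcard
      (v := fun i => if i = i₀ then p else ‖w‖⁻¹ • w) (s := {i₀, i₁}) (by
        constructor
        · rintro ⟨i, rfl | rfl⟩
          · simpa using hp
          · simp [Set.domRestrict, h01.symm, norm_smul, hw0.ne']
        · rintro ⟨i, rfl | rfl⟩ ⟨j, rfl | rfl⟩ hij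
          · exact absurd rfl hij
          · simp [Set.domRestrict, h01.symm, inner_smul_right, hpw]
          · simp [Set.domRestrict, h01.symm, inner_smul_left, real_inner_comm, hpw]
          · exact absurd rfl hij)
    have hb0 : b i₀ = p := by simpa using hb i₀ (by simp)
    have hb1 : b i₁ = ‖w‖⁻¹ • w := by simpa [h01.symm] using hb i₁ (by simp)
    have hprod : ∏ i, (if i = i₀ then δ else if i = i₁ then ‖w‖⁻¹ * (2 * δ) else 1) =
        δ * (‖w‖⁻¹ * (2 * δ)) := by
      rw [Finset.prod_eq_mul i₀ i₁ h01 (fun i _ hi => by simp [hi.1, hi.2]) (by simp) (by simp)]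
      simp [h01.symm]
    refine (hmono (r := C * (δ * (‖w‖⁻¹ * (2 * δ)))) (by positivity) ?_ ((h b
      (fun i => if i = i₀ then δ else if i = i₁ then ‖w‖⁻¹ * (2 * δ) else 1)
      fun i => by split_ifs <;> positivity).trans (le_of_eq (by rw [hprod])))).trans ?_
    · intro x hx hxS i
      split_ifs with hi hi
      · rw [hi, hb0]
        exact hxS.1
      · rw [hi, hb1, inner_smul_left, RCLike.conj_to_real, abs_mul, abs_of_pos (inv_pos.mpr hw0)]
        refine mul_le_mul_of_nonneg_left ?_ (inv_nonneg.mpr hw0.le)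
        rw [hw, inner_sub_left, inner_smul_left, RCLike.conj_to_real]
        have e3 : |⟪p, q⟫| ≤ 1 := by simpa [hp, hq] using abs_real_inner_le_norm p q
        have e4 : |⟪p, q⟫ * ⟪p, x⟫| ≤ 1 * δ := by
          rw [abs_mul]
          exact mul_le_mul e3 hxS.1 (abs_nonneg _) zero_le_one
        exact (abs_sub _ _).trans (by linarith [hxS.2])
      · simpa [hx] using abs_real_inner_le_norm (b i) x
    · rw [le_div_iff₀ hpqn]
      have : ‖w‖⁻¹ * ‖p - q‖ ≤ 2 := by
        rw [inv_mul_le_iff₀ hw0]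
        linarith
      calc C * (δ * (‖w‖⁻¹ * (2 * δ))) * ‖p - q‖ = 2 * C * δ ^ 2 * (‖w‖⁻¹ * ‖p - q‖) := by ring
        _ ≤ 2 * C * δ ^ 2 * 2 := by gcongr
        _ = _ := by ring

end HausdorffSphere

section Curve

theorem exists_forall_norm_sub_sub_smul_deriv_le {F : Type*} [NormedAddCommGroup F]
    [NormedSpace ℝ F] {f : ℝ → F} (hf : ContDiff ℝ 1 f) (a b : ℝ) {ε : ℝ} (hε : 0 < ε) :
    ∃ ρ > 0, ∀ s ∈ Set.Icc a b, ∀ t ∈ Set.Icc a b, |s - t| ≤ ρ →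
      ‖f s - f t - (s - t) • deriv f t‖ ≤ ε * |s - t| := by
  have hu := isCompact_Icc.uniformContinuousOn_of_continuous
    (hf.continuous_deriv le_rfl).continuousOn (s := Set.Icc a b)
  obtain ⟨ρ, hρ, h⟩ := Metric.uniformContinuousOn_iff_le.mp hu ε hε
  refine ⟨ρ, hρ, fun s hs t ht hst => ?_⟩
  have hsub : Set.uIcc t s ⊆ Set.Icc a b := Set.uIcc_subset_Icc ht hs
  have key := (convex_uIcc t s).norm_image_sub_le_of_norm_hasDerivWithin_le
    (f := fun x => f x - x • deriv f t) (f' := fun x => deriv f x - deriv f t) (C := ε)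
    (fun x _ => by
      have h2 := (hasDerivAt_id x).smul_const (deriv f t)
      rw [one_smul] at h2
      exact ((hf.differentiable one_ne_zero x).hasDerivAt.sub h2).hasDerivWithinAt)
    (fun x hx => by
      rw [← dist_eq_norm]
      refine h x (hsub hx) t ht ?_
      rw [Real.dist_eq]
      exact (Set.abs_sub_left_of_mem_uIcc hx).trans hst)
    Set.left_mem_uIcc Set.right_mem_uIcc
  rw [Real.norm_eq_abs] at key
  refine (le_of_eq ?_).trans key
  congr 1
  rw [sub_smul]
  abel

end Curve

section Cutoff

theorem exists_dyadic_cutoff_bound {η : ℝ → ℝ} (hη : ContDiff ℝ 1 η)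
    (hηs : Function.support η ⊆ Set.Ioo (-1) 1) :
    ∃ M > 0, ∀ l : ℕ, 1 ≤ l →
      ContDiff ℝ 1 (fun x => η ((2 : ℝ) ^ (l - 1) * x) - η ((2 : ℝ) ^ l * x)) ∧
      ∀ x, |η ((2 : ℝ) ^ (l - 1) * x) - η ((2 : ℝ) ^ l * x)| ≤ M ∧
        |deriv (fun x => η ((2 : ℝ) ^ (l - 1) * x) - η ((2 : ℝ) ^ l * x)) x| ≤ M / ((2 : ℝ) ^ l)⁻¹ ∧
        (2 * ((2 : ℝ) ^ l)⁻¹ < |x| → η ((2 : ℝ) ^ (l - 1) * x) - η ((2 : ℝ) ^ l * x) = 0 ∧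
          deriv (fun x => η ((2 : ℝ) ^ (l - 1) * x) - η ((2 : ℝ) ^ l * x)) x = 0) := by
  have hz : ∀ x, 1 ≤ |x| → η x = 0 := fun x hx => by
    by_contra h
    exact absurd (abs_lt.mpr (hηs h)) (not_lt.mpr hx)
  have hz' : ∀ x, 1 < |x| → deriv η x = 0 := fun x hx => by
    have : η =ᶠ[nhds x] fun _ => 0 := by
      filter_upwards [(isOpen_lt continuous_const continuous_abs).mem_nhds hx] with y hy
      exact hz y (le_of_lt hy)
    rw [this.deriv_eq]
    simp
  have hc : HasCompactSupport η :=
    HasCompactSupport.intro (isCompact_Icc (a := (-1 : ℝ)) (b := 1)) fun x hx => hz x (by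
      by_contra! h
      exact hx (abs_le.mp h.le))
  obtain ⟨C₁, h₁⟩ := hc.exists_bound_of_continuous hη.continuous
  obtain ⟨C₂, h₂⟩ := hc.deriv.exists_bound_of_continuous (hη.continuous_deriv le_rfl)
  set K := max (max C₁ C₂) 1 with hK
  have hK0 : 0 < K := by positivity
  have b₁ : ∀ x, |η x| ≤ K := fun x => (h₁ x).trans (le_max_of_le_left (le_max_left _ _))
  have b₂ : ∀ x, |deriv η x| ≤ K := fun x => (h₂ x).trans (le_max_of_le_left (le_max_right _ _))
  refine ⟨2 * K, by positivity, fun l hl => ⟨?_, fun x => ?_⟩⟩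
  · exact (hη.comp (contDiff_const.mul contDiff_id)).sub
      (hη.comp (contDiff_const.mul contDiff_id))
  have hpow : (2 : ℝ) ^ l = 2 * 2 ^ (l - 1) := by
    rw [← pow_succ', Nat.sub_add_cancel hl]
  have hp : (0 : ℝ) < 2 ^ (l - 1) := by positivity
  have hd : deriv (fun x => η ((2 : ℝ) ^ (l - 1) * x) - η ((2 : ℝ) ^ l * x)) x =
      2 ^ (l - 1) * deriv η (2 ^ (l - 1) * x) - 2 ^ l * deriv η (2 ^ l * x) := by
    have hη' : ∀ c : ℝ, HasDerivAt (fun x => η (c * x)) (c * deriv η (c * x)) x := fun c => by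
      have h1 := (hasDerivAt_id x).const_mul c
      have h2 : HasDerivAt (fun x => η (c * x)) (deriv η (c * x) * (c * 1)) x :=
        (hη.differentiable one_ne_zero (c * x)).hasDerivAt.comp x h1
      rwa [mul_one, mul_comm] at h2
    exact ((hη' _).sub (hη' _)).deriv
  rw [hd]
  refine ⟨(abs_sub _ _).trans (by linarith [b₁ (2 ^ (l - 1) * x), b₁ (2 ^ l * x)]), ?_,
    fun hx => ?_⟩
  · refine (abs_sub _ _).trans ?_
    rw [abs_mul, abs_mul, abs_of_pos hp, hpow, abs_of_pos (by positivity : (0:ℝ) < 2 * 2 ^ (l - 1)),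
      div_inv_eq_mul]
    have t1 := mul_le_mul_of_nonneg_left (b₂ (2 ^ (l - 1) * x)) hp.le
    have t2 := mul_le_mul_of_nonneg_left (b₂ (2 * 2 ^ (l - 1) * x)) hp.le
    nlinarith [mul_pos hp hK0]
  · have e1 : 1 < |2 ^ (l - 1) * x| := by
      rw [abs_mul, abs_of_pos hp]
      rw [hpow, mul_inv, ← mul_assoc, mul_inv_cancel₀ two_ne_zero, one_mul,
        inv_lt_iff_one_lt_mul₀ hp] at hx
      linarith
    have e2 : 1 < |2 ^ l * x| := by
      rw [hpow, mul_assoc, abs_mul, abs_two]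
      linarith
    rw [hz _ e1.le, hz _ e2.le, hz' _ e1, hz' _ e2]
    simp

end Cutoff

section Kernel

variable {d : ℕ}

/-- The size of the kernel `∫ f(s,ω) conj f(t,ω) dω` in terms of `τ = s - t`, where `δ = 2⁻ˡ`. -/
noncomputable def kernelBound (δ R τ : ℝ) : ℝ :=
  if |τ| ≤ δ then δ else if |τ| ≤ (R * δ)⁻¹ then δ ^ 2 * |τ|⁻¹ else δ / R * (|τ| ^ 2)⁻¹

theorem exists_norm_integral_exp_mul_mul_le (hd : 2 ≤ d) :
    ∃ C : ℝ, 0 < C ∧ ∀ (p q v : EuclideanSpace ℝ (Fin d)) (ψ : ℝ → ℝ) (δ M τ κ R : ℝ),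
      ‖p‖ = 1 → ‖q‖ = 1 → 0 ≤ ⟪p, q⟫ → 0 < κ → κ ≤ 1 → 0 < R → 0 < δ → δ ≤ 1 → R * δ ^ 2 ≤ 1 →
      0 < M → |τ| ≤ 1 → κ * |τ| ≤ ‖p - q‖ → ‖v - τ • q‖ ≤ 1 / 8 * |τ| → ContDiff ℝ 1 ψ →
      (∀ x, |ψ x| ≤ M ∧ |deriv ψ x| ≤ M / δ ∧ (2 * δ < |x| → ψ x = 0 ∧ deriv ψ x = 0)) →
      ‖∫ ω, Complex.exp (Complex.I * ((R * ⟪v, ω⟫ : ℝ) : ℂ)) *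
        ((ψ ⟪p, ω⟫ * ψ ⟪q, ω⟫ : ℝ) : ℂ) ∂(sphereMeasure d)‖ ≤
        C * (M ^ 2 / κ) * kernelBound δ R τ := by
  have := isFiniteMeasure_sphereMeasure (d := d) (by omega)
  obtain ⟨C₁, hC₁, hosc⟩ := exists_norm_integral_exp_mul_le d
  obtain ⟨C₂, hC₂, hslab⟩ := exists_sphereMeasure_slab_le hd
  refine ⟨C₂ * 200 * (C₁ + 1), by positivity, ?_⟩
  intro p q v ψ δ M τ κ R hp hq hpq hκ hκ1 hR hδ hδ1 hRδ hM hτ hpqκ hv hψ hψb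
  set W : Set (EuclideanSpace ℝ (Fin d)) := {x | |⟪p, x⟫| ≤ 2 * δ ∧ |⟪q, x⟫| ≤ 2 * δ} with hW
  obtain ⟨hs1, hs2⟩ := hslab p q hp hq hpq (2 * δ) (by positivity)
  rw [← hW] at hs1 hs2
  have hc : ∀ r : EuclideanSpace ℝ (Fin d), IsClosed {x | |⟪r, x⟫| ≤ 2 * δ} := fun r =>
    isClosed_le (by fun_prop) continuous_const
  have hWm : MeasurableSet W := ((hc p).inter (hc q)).measurableSet
  set a : EuclideanSpace ℝ (Fin d) → ℝ := fun ω => ψ ⟪p, ω⟫ * ψ ⟪q, ω⟫ with ha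
  have hd1 : ∀ (r ω : EuclideanSpace ℝ (Fin d)),
      HasFDerivAt (fun ω => ψ ⟪r, ω⟫) (deriv ψ ⟪r, ω⟫ • innerSL ℝ r) ω := fun r ω =>
    (hψ.differentiable one_ne_zero _).hasDerivAt.comp_hasFDerivAt ω (innerSL ℝ r).hasFDerivAt
  have hac : ContDiff ℝ 1 a :=
    (hψ.comp (innerSL ℝ p).contDiff).mul (hψ.comp (innerSL ℝ q).contDiff)
  have had : ∀ ω, fderiv ℝ a ω = ψ ⟪p, ω⟫ • (deriv ψ ⟪q, ω⟫ • innerSL ℝ q) +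
      ψ ⟪q, ω⟫ • (deriv ψ ⟪p, ω⟫ • innerSL ℝ p) := fun ω =>
    ((hd1 p ω).mul (hd1 q ω)).fderiv
  have hout : ∀ ω ∉ W, a ω = 0 ∧ fderiv ℝ a ω = 0 := by
    intro ω hω
    rw [hW, Set.mem_ofPred_eq, not_and_or, not_le, not_le] at hω
    rcases hω with h | h
    · obtain ⟨h1, h2⟩ := (hψb _).2.2 h
      exact ⟨by simp [ha, h1], by rw [had, h1, h2]; simp⟩
    · obtain ⟨h1, h2⟩ := (hψb _).2.2 h
      exact ⟨by simp [ha, h1], by rw [had, h1, h2]; simp⟩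
  have ha0 : ∀ ω, |a ω| ≤ M ^ 2 := fun ω => by
    rw [ha, abs_mul, sq]
    exact mul_le_mul (hψb _).1 (hψb _).1 (abs_nonneg _) hM.le
  have ha1 : ∀ ω, ‖fderiv ℝ a ω‖ ≤ 2 * M ^ 2 / δ := fun ω => by
    have : ∀ r r' : EuclideanSpace ℝ (Fin d), ‖r'‖ = 1 →
        ‖ψ ⟪r, ω⟫ • (deriv ψ ⟪r', ω⟫ • innerSL ℝ r')‖ ≤ M * (M / δ) := fun r r' hr' => by
      rw [norm_smul, norm_smul, innerSL_apply_norm, hr', mul_one]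
      exact mul_le_mul (hψb _).1 (hψb _).2.1 (norm_nonneg _) hM.le
    rw [had]
    refine (norm_add_le _ _).trans ((add_le_add (this p q hq) (this q p hp)).trans
      (le_of_eq (by ring)))
  set I := ∫ ω, Complex.exp (Complex.I * ((R * ⟪v, ω⟫ : ℝ) : ℂ)) * (a ω : ℂ) ∂(sphereMeasure d)
  have htriv : ‖I‖ ≤ M ^ 2 * (sphereMeasure d).real W := by
    refine (norm_integral_le_of_norm_le ((integrable_const (M ^ 2)).indicator hWm)
      (Filter.Eventually.of_forall fun ω => ?_)).trans (le_of_eq ?_)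
    · rw [norm_mul, mul_comm Complex.I, Complex.norm_exp_ofReal_mul_I, one_mul, Complex.norm_real]
      by_cases hω : ω ∈ W
      · rw [Set.indicator_of_mem hω]
        exact ha0 ω
      · rw [Set.indicator_of_notMem hω, (hout ω hω).1, norm_zero]
    · rw [integral_indicator hWm, setIntegral_const, smul_eq_mul, mul_comm]
  have hM2 : M ^ 2 ≤ M ^ 2 / κ := by
    rw [le_div_iff₀ hκ]
    nlinarith [sq_nonneg M]
  have hb1 : ‖I‖ ≤ C₂ * 2 * (M ^ 2 / κ) * δ := by
    calc ‖I‖ ≤ M ^ 2 * (C₂ * (2 * δ)) := htriv.trans (mul_le_mul_of_nonneg_left hs1 (sq_nonneg M))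
      _ ≤ (M ^ 2 / κ) * (C₂ * (2 * δ)) := mul_le_mul_of_nonneg_right hM2 (by positivity)
      _ = _ := by ring
  have hX : 0 < C₂ * (M ^ 2 / κ) := by positivity
  unfold kernelBound
  split_ifs with h1 h2
  · refine hb1.trans ?_
    have : 0 < C₂ * (M ^ 2 / κ) * δ := by positivity
    nlinarith [mul_pos this hC₁]
  all_goals
    have hτ0 : 0 < |τ| := hδ.trans (not_le.mp h1)
    have hne : p ≠ q := by
      rintro rfl
      rw [sub_self, norm_zero] at hpqκ
      exact absurd hpqκ (not_le.mpr (by positivity))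
    have hmeas : (sphereMeasure d).real W ≤ C₂ * 4 * κ⁻¹ * (δ ^ 2 * |τ|⁻¹) := by
      refine (hs2 hne).trans ?_
      calc C₂ * (2 * δ) ^ 2 / ‖p - q‖ ≤ C₂ * (2 * δ) ^ 2 / (κ * |τ|) := by gcongr
        _ = _ := by
          field_simp
          ring
  · calc ‖I‖ ≤ M ^ 2 * (C₂ * 4 * κ⁻¹ * (δ ^ 2 * |τ|⁻¹)) :=
        htriv.trans (mul_le_mul_of_nonneg_left hmeas (sq_nonneg M))
      _ = C₂ * (M ^ 2 / κ) * (δ ^ 2 * |τ|⁻¹) * 4 := by ring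
      _ ≤ C₂ * (M ^ 2 / κ) * (δ ^ 2 * |τ|⁻¹) * (200 * (C₁ + 1)) := by
        gcongr
        linarith
      _ = _ := by ring
  · by_cases hδ8 : 1 / 8 < δ
    · have hR64 : R ≤ 64 := by nlinarith
      have : δ ≤ 64 * (δ / R * (|τ| ^ 2)⁻¹) := by
        have : R * |τ| ^ 2 ≤ 64 * 1 := by
          gcongr
          exact pow_le_one₀ (abs_nonneg _) hτ
        rw [div_mul_eq_mul_div, ← div_eq_mul_inv, div_div, mul_div_assoc',
          le_div_iff₀ (by positivity)]
        nlinarith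
      calc ‖I‖ ≤ C₂ * 2 * (M ^ 2 / κ) * δ := hb1
        _ ≤ C₂ * 2 * (M ^ 2 / κ) * (64 * (δ / R * (|τ| ^ 2)⁻¹)) := by gcongr
        _ = C₂ * (M ^ 2 / κ) * (δ / R * (|τ| ^ 2)⁻¹) * 128 := by ring
        _ ≤ C₂ * (M ^ 2 / κ) * (δ / R * (|τ| ^ 2)⁻¹) * (200 * (C₁ + 1)) := by
          gcongr
          linarith
        _ = _ := by ring
    push Not at hδ8
    have hτq : ‖τ • q‖ = |τ| := by rw [norm_smul, hq, mul_one, Real.norm_eq_abs]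
    have hvn : 7 / 8 * |τ| ≤ ‖v‖ := by
      have := norm_sub_norm_le (τ • q) v
      rw [norm_sub_rev, hτq] at this
      linarith
    have hv0 : 0 < ‖v‖ := lt_of_lt_of_le (by positivity) hvn
    set u := ‖v‖⁻¹ • v with hu
    have hun : ‖u‖ = 1 := by rw [hu, norm_smul, norm_inv, norm_norm, inv_mul_cancel₀ hv0.ne']
    have huv : ∀ ω, R * ⟪v, ω⟫ = R * ‖v‖ * ⟪u, ω⟫ := fun ω => by
      rw [hu, inner_smul_left, RCLike.conj_to_real]
      field_simp
    have hux : ∀ ω ∈ W, ‖ω‖ = 1 → |⟪u, ω⟫| ≤ 1 / 2 := by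
      intro ω hω hωn
      have e1 : |⟪v, ω⟫| ≤ 3 / 8 * |τ| := by
        have : ⟪v, ω⟫ = ⟪v - τ • q, ω⟫ + τ * ⟪q, ω⟫ := by
          rw [inner_sub_left, inner_smul_left, RCLike.conj_to_real]
          ring
        rw [this]
        have e2 : |⟪v - τ • q, ω⟫| ≤ 1 / 8 * |τ| :=
          (abs_real_inner_le_norm _ _).trans (by rwa [hωn, mul_one])
        have e3 : |τ * ⟪q, ω⟫| ≤ |τ| * (1 / 4) := by
          rw [abs_mul]
          gcongr
          exact hω.2.trans (by linarith)
        exact (abs_add_le _ _).trans (by linarith)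
      rw [hu, inner_smul_left, RCLike.conj_to_real, abs_mul, abs_inv, abs_norm,
        inv_mul_le_iff₀ hv0]
      linarith
    have hmain := hosc (EuclideanSpace.basisFun (Fin d) ℝ) ae_norm_eq_one_sphereMeasure
      measurePreserving_sphereMeasure hun hac hWm (M₀ := M ^ 2) (M₁ := 2 * M ^ 2 / δ)
      (lam := R * ‖v‖) (sq_nonneg M) (by positivity) (by positivity) hout
      fun ω hω hωn => ⟨hux ω hω hωn, ha0 ω, ha1 ω⟩
    simp only [← huv] at hmain
    have hM3 : M ^ 2 + 2 * M ^ 2 / δ ≤ 3 * M ^ 2 / δ := by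
      rw [le_div_iff₀ hδ, add_mul, div_mul_cancel₀ _ hδ.ne']
      nlinarith [sq_nonneg M]
    calc ‖I‖ ≤ C₁ / (R * ‖v‖) * (M ^ 2 + 2 * M ^ 2 / δ) * (sphereMeasure d).real W := hmain
      _ ≤ C₁ / (R * (7 / 8 * |τ|)) * (3 * M ^ 2 / δ) * (C₂ * 4 * κ⁻¹ * (δ ^ 2 * |τ|⁻¹)) := by
        gcongr
      _ = C₂ * (M ^ 2 / κ) * (δ / R * (|τ| ^ 2)⁻¹) * (96 / 7 * C₁) := by
        field_simp
        ring
      _ ≤ C₂ * (M ^ 2 / κ) * (δ / R * (|τ| ^ 2)⁻¹) * (200 * (C₁ + 1)) := by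
        refine mul_le_mul_of_nonneg_left ?_ (by positivity)
        linarith
      _ = _ := by ring

end Kernel

section KernelIntegral

theorem kernelBound_nonneg {δ R : ℝ} (hδ : 0 < δ) (hR : 0 < R) (τ : ℝ) :
    0 ≤ kernelBound δ R τ := by
  unfold kernelBound
  split_ifs <;> positivity

theorem integral_kernelBound {δ R : ℝ} (hδ : 0 < δ) (hR : 0 < R) (h : R * δ ^ 2 ≤ 1) :
    ∫ τ, kernelBound δ R τ = 2 * (δ ^ 2 * (2 + Real.log ((R * δ ^ 2)⁻¹))) := by
  set f : ℝ → ℝ := fun x =>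
    if x ≤ δ then δ else if x ≤ (R * δ)⁻¹ then δ ^ 2 * x⁻¹ else δ / R * (x ^ 2)⁻¹ with hf
  set L := (R * δ)⁻¹ with hL
  have hL0 : 0 < L := by positivity
  have hδL : δ ≤ L := by
    rw [hL, le_inv_comm₀ hδ (by positivity), le_inv_comm₀ (by positivity) hδ,
      ← one_div, le_div_iff₀ (by positivity)]
    nlinarith
  have e1 : Set.EqOn f (fun _ => δ) (Set.Ioc 0 δ) := fun x hx => if_pos hx.2
  have e2 : Set.EqOn f (fun x => δ ^ 2 * x⁻¹) (Set.Ioc δ L) := fun x hx => by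
    simp only [hf, if_neg (not_le.mpr hx.1), if_pos hx.2]
  have e3 : Set.EqOn f (fun x => δ / R * x ^ (-2 : ℝ)) (Set.Ioi L) := fun x hx => by
    have hx0 : 0 < x := hL0.trans hx
    simp only [hf, if_neg (not_le.mpr (hδL.trans_lt hx)), if_neg (not_le.mpr (Set.mem_Ioi.mp hx))]
    rw [Real.rpow_neg hx0.le, Real.rpow_two]
  have i1 : IntegrableOn f (Set.Ioc 0 δ) :=
    (integrableOn_const (by simp)).congr_fun e1.symm measurableSet_Ioc
  have i2 : IntegrableOn f (Set.Ioc δ L) := by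
    refine IntegrableOn.congr_fun ?_ e2.symm measurableSet_Ioc
    refine (ContinuousOn.integrableOn_Icc ?_).mono_set Set.Ioc_subset_Icc_self
    exact continuousOn_const.mul (continuousOn_id.inv₀ fun x hx => (hδ.trans_le hx.1).ne')
  have i3 : IntegrableOn f (Set.Ioi L) :=
    IntegrableOn.congr_fun ((integrableOn_Ioi_rpow_of_lt (by norm_num) hL0).const_mul _)
      e3.symm measurableSet_Ioi
  have v1 : ∫ x in Set.Ioc 0 δ, f x = δ ^ 2 := by
    rw [setIntegral_congr_fun measurableSet_Ioc e1, setIntegral_const,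
      Real.volume_real_Ioc_of_le hδ.le, smul_eq_mul]
    ring
  have v2 : ∫ x in Set.Ioc δ L, f x = δ ^ 2 * Real.log ((R * δ ^ 2)⁻¹) := by
    rw [setIntegral_congr_fun measurableSet_Ioc e2, integral_const_mul,
      ← intervalIntegral.integral_of_le hδL, integral_inv_of_pos hδ hL0, hL]
    congr 2
    field_simp
  have v3 : ∫ x in Set.Ioi L, f x = δ ^ 2 := by
    rw [setIntegral_congr_fun measurableSet_Ioi e3, integral_const_mul,
      integral_Ioi_rpow_of_lt (by norm_num) hL0, hL]
    norm_num [Real.rpow_neg_one]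
    field_simp
  have hk : ∀ τ, kernelBound δ R τ = f |τ| := fun τ => rfl
  simp only [hk]
  rw [integral_comp_abs, ← Set.Ioc_union_Ioi_eq_Ioi hδ.le, ← Set.Ioc_union_Ioi_eq_Ioi hδL,
    setIntegral_union _ (measurableSet_Ioc.union measurableSet_Ioi) i1 (i2.union i3),
    setIntegral_union (Set.Ioc_disjoint_Ioi le_rfl) measurableSet_Ioi i2 i3, v1, v2, v3]
  · ring
  · rw [Set.Ioc_union_Ioi_eq_Ioi hδL]
    exact Set.Ioc_disjoint_Ioi le_rfl

theorem integrable_kernelBound {δ R : ℝ} (hδ : 0 < δ) (hR : 0 < R) (h : R * δ ^ 2 ≤ 1) :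
    Integrable (kernelBound δ R) := by
  refine not_imp_comm.mp integral_undef ?_
  rw [integral_kernelBound hδ hR h]
  have : 0 ≤ Real.log ((R * δ ^ 2)⁻¹) := Real.log_nonneg ((one_le_inv₀ (by positivity)).mpr h)
  positivity

end KernelIntegral

section Fubini

open scoped ComplexConjugate

theorem integral_norm_integral_sq_le {Ω : Type*} [TopologicalSpace Ω] [SecondCountableTopology Ω]
    [MeasurableSpace Ω] [BorelSpace Ω] {σ : Measure Ω} [IsFiniteMeasure σ] {f : ℝ → Ω → ℂ}
    (hf : Continuous (Function.uncurry f)) {J : Set ℝ} (hJ : MeasurableSet J)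
    (hJfin : volume J ≠ ⊤) {K : ℝ} (hfK : ∀ s ω, ‖f s ω‖ ≤ J.indicator (fun _ => K) s)
    {G : ℝ × ℝ → ℝ} (hG : Integrable G)
    (hfG : ∀ s t, ‖∫ ω, f s ω * conj (f t ω) ∂σ‖ ≤ G (s, t)) :
    ∫ ω, ‖∫ s, f s ω‖ ^ 2 ∂σ ≤ ∫ z, G z := by
  have hJi : Integrable (J.indicator fun _ => K) :=
    (integrable_indicator_iff hJ).mpr (integrableOn_const hJfin)
  have h_int : Integrable (fun w : Ω × (ℝ × ℝ) => f w.2.1 w.1 * conj (f w.2.2 w.1))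
      (σ.prod (volume.prod volume)) := by
    refine Integrable.mono' ((integrable_const (1 : ℝ)).mul_prod (hJi.mul_prod hJi)) ?_ ?_
    · have h1 : Continuous fun w : Ω × (ℝ × ℝ) => f w.2.1 w.1 :=
        hf.comp ((continuous_fst.comp continuous_snd).prodMk continuous_fst)
      have h2 : Continuous fun w : Ω × (ℝ × ℝ) => f w.2.2 w.1 :=
        hf.comp ((continuous_snd.comp continuous_snd).prodMk continuous_fst)
      exact (h1.mul (Complex.continuous_conj.comp h2)).aestronglyMeasurable
    · refine Filter.Eventually.of_forall fun w => ?_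
      rw [norm_mul, RCLike.norm_conj, one_mul]
      exact mul_le_mul (hfK _ _) (hfK _ _) (norm_nonneg _) ((norm_nonneg _).trans (hfK w.2.1 w.1))
  have hsq : ∀ ω, ((‖∫ s, f s ω‖ ^ 2 : ℝ) : ℂ) =
      ∫ z : ℝ × ℝ, f z.1 ω * conj (f z.2 ω) ∂(volume.prod volume) := fun ω => by
    rw [integral_prod_mul (fun s => f s ω) fun t => conj (f t ω), integral_conj, Complex.mul_conj,
      Complex.normSq_eq_norm_sq]
  have hval : ((∫ ω, ‖∫ s, f s ω‖ ^ 2 ∂σ : ℝ) : ℂ) =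
      ∫ z : ℝ × ℝ, ∫ ω, f z.1 ω * conj (f z.2 ω) ∂σ := by
    rw [← integral_complex_ofReal]
    simp only [hsq]
    exact integral_integral_swap h_int
  calc ∫ ω, ‖∫ s, f s ω‖ ^ 2 ∂σ = ‖((∫ ω, ‖∫ s, f s ω‖ ^ 2 ∂σ : ℝ) : ℂ)‖ := by
        rw [Complex.norm_real, Real.norm_of_nonneg (integral_nonneg fun _ => sq_nonneg _)]
    _ ≤ ∫ z, G z := by
        rw [hval]
        exact norm_integral_le_of_norm_le hG (Filter.Eventually.of_forall fun z => hfG z.1 z.2)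

theorem integrable_indicator_mul_comp_sub {J : Set ℝ} (hJ : MeasurableSet J)
    (hJfin : volume J ≠ ⊤) {k : ℝ → ℝ} (hk : Integrable k) (A : ℝ) :
    Integrable (fun z : ℝ × ℝ => J.indicator (fun _ => A) z.2 * k (z.1 - z.2)) ∧
    ∫ z : ℝ × ℝ, J.indicator (fun _ => A) z.2 * k (z.1 - z.2) =
      volume.real J * A * ∫ τ, k τ := by
  have hJi : Integrable (J.indicator fun _ => A) :=
    (integrable_indicator_iff hJ).mpr (integrableOn_const hJfin)
  have hi := hJi.convolution_integrand (ContinuousLinearMap.mul ℝ ℝ) hk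
  refine ⟨hi, ?_⟩
  have h := integral_convolution (ContinuousLinearMap.mul ℝ ℝ) hJi hk
  rw [ContinuousLinearMap.mul_apply', integral_indicator hJ, setIntegral_const, smul_eq_mul] at h
  exact (integral_prod _ hi).trans h

end Fubini

section Geometry

theorem exists_forall_curve_bounds {F : Type*} [NormedAddCommGroup F] [InnerProductSpace ℝ F]
    {γ : ℝ → F} (hγ : ContDiff ℝ 2 γ) {a b c : ℝ} (hc : 0 < c)
    (harc : ∀ s ∈ Set.Icc a b, ‖deriv γ s‖ = 1)
    (hcurv : ∀ s ∈ Set.Icc a b, c ≤ ‖deriv (deriv γ) s‖) :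
    ∃ ρ : ℝ, 0 < ρ ∧ ρ ≤ 1 ∧ ∀ s ∈ Set.Icc a b, ∀ t ∈ Set.Icc a b, |s - t| ≤ ρ →
      0 ≤ ⟪deriv γ s, deriv γ t⟫ ∧ c / 2 * |s - t| ≤ ‖deriv γ s - deriv γ t‖ ∧
      ‖γ s - γ t - (s - t) • deriv γ t‖ ≤ 1 / 8 * |s - t| := by
  have hγ' : ContDiff ℝ 1 (deriv γ) :=
    (contDiff_succ_iff_deriv.mp (by simpa [one_add_one_eq_two] using hγ :
      ContDiff ℝ (1 + 1) γ)).2.2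
  obtain ⟨ρ₁, hρ₁, h₁⟩ := exists_forall_norm_sub_sub_smul_deriv_le
    (hγ.of_le one_le_two) a b (ε := 1 / 8) (by norm_num)
  obtain ⟨ρ₂, hρ₂, h₂⟩ := exists_forall_norm_sub_sub_smul_deriv_le hγ' a b (half_pos hc)
  have hu := isCompact_Icc.uniformContinuousOn_of_continuous
    hγ'.continuous.continuousOn (s := Set.Icc a b)
  obtain ⟨ρ₃, hρ₃, h₃⟩ := Metric.uniformContinuousOn_iff_le.mp hu 1 one_pos
  refine ⟨min (min ρ₁ ρ₂) (min ρ₃ 1), by positivity,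
    (min_le_right _ _).trans (min_le_right _ _), fun s hs t ht hst => ⟨?_, ?_, ?_⟩⟩
  · have h := h₃ s hs t ht
      (hst.trans ((min_le_right _ _).trans (min_le_left _ _)))
    rw [dist_eq_norm] at h
    have e := norm_sub_sq_real (deriv γ s) (deriv γ t)
    rw [harc s hs, harc t ht] at e
    nlinarith [norm_nonneg (deriv γ s - deriv γ t)]
  · have h := h₂ s hs t ht (hst.trans ((min_le_left _ _).trans (min_le_right _ _)))
    have e := norm_sub_norm_le ((s - t) • deriv (deriv γ) t) (deriv γ s - deriv γ t)
    rw [norm_sub_rev _ (deriv γ s - deriv γ t), norm_smul, Real.norm_eq_abs] at e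
    have := mul_le_mul_of_nonneg_left (hcurv t ht) (abs_nonneg (s - t))
    linarith
  · exact h₁ s hs t ht (hst.trans ((min_le_left _ _).trans (min_le_left _ _)))

end Geometry

/-- The `L²(S^{d-1})` bound for the localized pieces
`g_{R,l}(ω) = ∫ e^{iR⟨ω,γ(s)⟩} χ(s) η_l(⟨ω,γ'(s)⟩) ds`: for
`R^{1/2} ≤ 2^l ≤ R`, `‖g_{R,l}‖_{L²} ≤ C 2^{-l}(1 + log(2^{2l}R^{-1}))^{1/2}`. -/
theorem stmt15 (d : ℕ) (hd : 2 ≤ d) (a b : ℝ) (hab : a < b) (c : ℝ) (hc : 0 < c)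
    (γ : ℝ → EuclideanSpace ℝ (Fin d)) (hγ : ContDiff ℝ 2 γ)
    (harc : ∀ s ∈ Set.Icc a b, ‖deriv γ s‖ = 1)
    (hcurv : ∀ s ∈ Set.Icc a b, c ≤ ‖deriv (deriv γ) s‖)
    (η : ℝ → ℝ) (hη : ContDiff ℝ (⊤ : ℕ∞) η) (hηs : Function.support η ⊆ Set.Ioo (-1) 1)
    (hη1 : ∀ s ∈ Set.Icc (-(1/2) : ℝ) (1/2), η s = 1) :
    ∃ ε₀ > 0, ∀ χ : ℝ → ℂ, ContDiff ℝ (⊤ : ℕ∞) χ →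
      (∃ t₀ ∈ Set.Icc a b,
        Function.support χ ⊆ Set.Ioo (t₀ - ε₀) (t₀ + ε₀) ∩ Set.Ioo a b) →
      ∃ C > 0, ∀ R : ℝ, 2 ≤ R → ∀ l : ℕ, 1 ≤ l →
        Real.sqrt R ≤ (2:ℝ)^l → (2:ℝ)^l ≤ R →
        (∫ ω in Metric.sphere (0 : EuclideanSpace ℝ (Fin d)) 1,
            ‖∫ s : ℝ, Complex.exp (Complex.I * ((R * ⟪ω, γ s⟫ : ℝ) : ℂ)) * χ s *
                ((η ((2:ℝ)^(l-1) * ⟪ω, deriv γ s⟫) - η ((2:ℝ)^l * ⟪ω, deriv γ s⟫) : ℝ) : ℂ)‖ ^ 2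
          ∂μH[(d:ℝ)-1]) ^ ((1:ℝ)/2) ≤
        C * (2:ℝ)^(-(l:ℝ)) * (1 + Real.log ((2:ℝ)^(2*l) / R)) ^ ((1:ℝ)/2) := by
  have hfin := isFiniteMeasure_sphereMeasure (d := d) (by omega)
  obtain ⟨ρ, hρ, hρ1, hgeom⟩ := exists_forall_curve_bounds hγ hc harc hcurv
  obtain ⟨C, hC, hker⟩ := exists_norm_integral_exp_mul_mul_le hd
  obtain ⟨M, hM, hcut⟩ := exists_dyadic_cutoff_bound (hη.of_le (by simp)) hηs
  refine ⟨ρ / 2, by positivity, fun χ hχ ⟨t₀, ht₀, hsupp⟩ => ?_⟩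
  set J : Set ℝ := Set.Ioo (t₀ - ρ / 2) (t₀ + ρ / 2) ∩ Set.Ioo a b with hJ
  have hJm : MeasurableSet J := measurableSet_Ioo.inter measurableSet_Ioo
  have hJfin : volume J ≠ ⊤ := ((measure_mono Set.inter_subset_left).trans_lt (by simp)).ne
  have hχ0 : ∀ s ∉ J, χ s = 0 := fun s hs => by
    by_contra h
    exact hs (hsupp h)
  obtain ⟨K₀, hK₀⟩ := (HasCompactSupport.intro (isCompact_Icc (a := a) (b := b)) fun s hs =>
    hχ0 s fun h => hs (Set.Ioo_subset_Icc_self h.2)).exists_bound_of_continuous hχ.continuous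
  have hK₀0 : 0 ≤ K₀ := (norm_nonneg _).trans (hK₀ 0)
  set κ := min 1 (c / 2) with hκ
  have hκ0 : 0 < κ := by positivity
  set A := K₀ ^ 2 * (C * (M ^ 2 / κ)) with hA
  have hA0 : 0 ≤ A := by positivity
  set D := volume.real J * A * 4 with hD
  have hD0 : 0 ≤ D := by positivity
  refine ⟨(D + 1) ^ ((1 : ℝ) / 2), by positivity, fun R hR l hl hRl _ => ?_⟩
  obtain ⟨hψ, hψb⟩ := hcut l hl
  set ψ : ℝ → ℝ := fun x => η ((2 : ℝ) ^ (l - 1) * x) - η ((2 : ℝ) ^ l * x) with hψdef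
  set δ := ((2 : ℝ) ^ l)⁻¹ with hδ
  have hδ0 : 0 < δ := by positivity
  have hδ1 : δ ≤ 1 := inv_le_one_of_one_le₀ (one_le_pow₀ one_le_two)
  have hR0 : 0 < R := by linarith
  have hRδ : R * δ ^ 2 ≤ 1 := by
    rw [hδ, inv_pow, ← div_eq_mul_inv, div_le_one (by positivity)]
    exact (Real.sqrt_le_left (by positivity)).mp hRl
  set f : ℝ → EuclideanSpace ℝ (Fin d) → ℂ := fun s ω =>
    Complex.exp (Complex.I * ((R * ⟪ω, γ s⟫ : ℝ) : ℂ)) * χ s * ((ψ ⟪ω, deriv γ s⟫ : ℝ) : ℂ) with hf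
  have hnf : ∀ s ω, ‖f s ω‖ = ‖χ s‖ * |ψ ⟪ω, deriv γ s⟫| := fun s ω => by
    rw [hf, norm_mul, norm_mul, mul_comm Complex.I, Complex.norm_exp_ofReal_mul_I, one_mul,
      Complex.norm_real, Real.norm_eq_abs]
  have hγc : Continuous γ := hγ.continuous
  have hγc' : Continuous (deriv γ) := hγ.continuous_deriv one_le_two
  have hψc : Continuous ψ := hψ.continuous
  have hχc : Continuous χ := hχ.continuous
  have hfc : Continuous (Function.uncurry f) := by
    simp only [hf, Function.uncurry_def]
    fun_prop
  have hfK : ∀ s ω, ‖f s ω‖ ≤ J.indicator (fun _ => K₀ * M) s := fun s ω => by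
    rw [hnf]
    by_cases hs : s ∈ J
    · rw [Set.indicator_of_mem hs]
      exact mul_le_mul (hK₀ s) (hψb _).1 (abs_nonneg _) hK₀0
    · rw [Set.indicator_of_notMem hs, hχ0 s hs, norm_zero, zero_mul]
  have hfG : ∀ s t, ‖∫ ω, f s ω * (starRingEnd ℂ) (f t ω) ∂(sphereMeasure d)‖ ≤
      J.indicator (fun _ => A) t * kernelBound δ R (s - t) := fun s t => by
    have hrhs : 0 ≤ J.indicator (fun _ => A) t * kernelBound δ R (s - t) :=
      mul_nonneg (Set.indicator_nonneg (fun _ _ => hA0) t) (kernelBound_nonneg hδ0 hR0 _)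
    have hprod : ∀ ω, f s ω * (starRingEnd ℂ) (f t ω) = χ s * (starRingEnd ℂ) (χ t) *
        (Complex.exp (Complex.I * ((R * ⟪γ s - γ t, ω⟫ : ℝ) : ℂ)) *
          ((ψ ⟪deriv γ s, ω⟫ * ψ ⟪deriv γ t, ω⟫ : ℝ) : ℂ)) := fun ω => by
      have he : Complex.exp (Complex.I * ((R * ⟪γ s - γ t, ω⟫ : ℝ) : ℂ)) =
          Complex.exp (Complex.I * ((R * ⟪ω, γ s⟫ : ℝ) : ℂ)) *
            (starRingEnd ℂ) (Complex.exp (Complex.I * ((R * ⟪ω, γ t⟫ : ℝ) : ℂ))) := by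
        rw [← Complex.exp_conj, ← Complex.exp_add, inner_sub_left, real_inner_comm ω (γ s),
          real_inner_comm ω (γ t), map_mul, Complex.conj_I, Complex.conj_ofReal]
        push_cast
        ring_nf
      rw [he, real_inner_comm ω (deriv γ s), real_inner_comm ω (deriv γ t)]
      simp only [hf, map_mul, Complex.conj_ofReal, Complex.ofReal_mul]
      ring
    simp only [hprod]
    rw [integral_const_mul, norm_mul, norm_mul, RCLike.norm_conj]
    by_cases hs : s ∈ J
    · by_cases ht : t ∈ J
      · have hs' : s ∈ Set.Icc a b := Set.Ioo_subset_Icc_self hs.2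
        have ht' : t ∈ Set.Icc a b := Set.Ioo_subset_Icc_self ht.2
        have hst : |s - t| ≤ ρ := by
          have h1 := hs.1
          have h2 := ht.1
          rw [abs_le]
          constructor <;> linarith [h1.1, h1.2, h2.1, h2.2]
        obtain ⟨g1, g2, g3⟩ := hgeom s hs' t ht' hst
        have hI := hker (deriv γ s) (deriv γ t) (γ s - γ t) ψ δ M (s - t) κ R (harc s hs')
          (harc t ht') g1 hκ0 (min_le_left _ _) hR0 hδ0 hδ1 hRδ hM (hst.trans hρ1)
          ((mul_le_mul_of_nonneg_right (min_le_right _ _) (abs_nonneg _)).trans g2) g3 hψ hψb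
        rw [Set.indicator_of_mem ht]
        refine (mul_le_mul (mul_le_mul (hK₀ s) (hK₀ t) (norm_nonneg _) hK₀0) hI (norm_nonneg _)
          (by positivity)).trans (le_of_eq ?_)
        rw [hA]
        ring
      · rw [hχ0 t ht, norm_zero, mul_zero, zero_mul]
        exact hrhs
    · rw [hχ0 s hs, norm_zero, zero_mul, zero_mul]
      exact hrhs
  obtain ⟨hGi, hGv⟩ := integrable_indicator_mul_comp_sub hJm hJfin
    (integrable_kernelBound hδ0 hR0 hRδ) A
  have hmain := integral_norm_integral_sq_le hfc hJm hJfin hfK hGi hfG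
  rw [hGv, integral_kernelBound hδ0 hR0 hRδ] at hmain
  have hlog : (R * δ ^ 2)⁻¹ = (2 : ℝ) ^ (2 * l) / R := by
    rw [hδ, mul_comm 2 l, pow_mul]
    field_simp
  have hL0 : 0 ≤ Real.log ((2 : ℝ) ^ (2 * l) / R) := by
    rw [← hlog]
    exact Real.log_nonneg ((one_le_inv₀ (by positivity)).mpr hRδ)
  rw [hlog] at hmain
  set L := Real.log ((2 : ℝ) ^ (2 * l) / R) with hL
  have hδr : (2 : ℝ) ^ (-(l : ℝ)) = (δ ^ 2) ^ ((1 : ℝ) / 2) := by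
    rw [← Real.sqrt_eq_rpow, Real.sqrt_sq hδ0.le, Real.rpow_neg zero_le_two, Real.rpow_natCast]
  rw [hδr, ← Real.mul_rpow (by positivity) (by positivity),
    ← Real.mul_rpow (by positivity) (by positivity)]
  refine Real.rpow_le_rpow (integral_nonneg fun _ => sq_nonneg _) (hmain.trans ?_) (by norm_num)
  have h1 : volume.real J * A * (2 * (δ ^ 2 * (2 + L))) = D * δ ^ 2 * (1 + L / 2) := by
    rw [hD]
    ring
  rw [h1]
  exact mul_le_mul (mul_le_mul_of_nonneg_right (by linarith) (sq_nonneg _)) (by linarith)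
    (by linarith) (by positivity)
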